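/- Let X be a compact metric space, T : X → X continuous, V* an open subset of Lip(X), and C* > 0 such that γ(φ) ≤ C* for all φ ∈ V*, where γ(φ) = sup_{n≥1, x∈X}(S_n φ(x) - n β(φ)). For φ ∈ V*, define K̂_φ := {x ∈ X : |S_k φ(T^l x) - k β(φ)| ≤ C* for all k ≥ 1, l ≥ 0} and K_φ := ∩_{m≥0} T^m(K̂_φ). Then for each φ ∈ V*: K_φ is compact, T(K_φ) = K_φ, and a T-invariant Borel probability measure μ maximizes φ if and only if supp μ ⊆ K_φ. -/

import Mathlib

open MeasureTheory Set

section

variable {X : Type*} [MetricSpace X] [MeasurableSpace X]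

noncomputable def beta (T : X → X) (φ : X → ℝ) : ℝ :=
  sSup ((fun μ : Measure X => ∫ x, φ x ∂μ) ''
    {μ : Measure X | IsProbabilityMeasure μ ∧ μ.map T = μ})

def msupp (μ : Measure X) : Set X := {x | ∀ U : Set X, IsOpen U → x ∈ U → 0 < μ U}

/-- `K̂_φ = {x : |S_k φ(T^l x) - k β(φ)| ≤ C* for all k ≥ 1, l ≥ 0}` -/
noncomputable def Khat (T : X → X) (φ : X → ℝ) (Cs : ℝ) : Set X :=
  {x | ∀ k : ℕ, 1 ≤ k → ∀ l : ℕ,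
    |∑ j ∈ Finset.range k, φ (T^[j] (T^[l] x)) - k * beta T φ| ≤ Cs}

/-- `K_φ = ⋂_{m≥0} T^m K̂_φ` -/
noncomputable def Kset (T : X → X) (φ : X → ℝ) (Cs : ℝ) : Set X :=
  ⋂ m : ℕ, T^[m] '' Khat T φ Cs

end

section helpers

variable {X : Type*} [MetricSpace X] [MeasurableSpace X]

lemma aux_sum_succ (T : X → X) (φ : X → ℝ) (n : ℕ) (x : X) :
    ∑ k ∈ Finset.range (n+1), φ (T^[k] x) =
      φ x + ∑ k ∈ Finset.range n, φ (T^[k] (T x)) := by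
  rw [Finset.sum_range_succ']
  simp [Function.iterate_succ_apply, add_comm]

lemma aux_closed (T : X → X) (hT : Continuous T) (φ : X → ℝ) (hφ : Continuous φ) (Cs : ℝ) :
    IsClosed (Khat T φ Cs) := by
  unfold Khat
  simp only [setOf_forall]
  refine isClosed_iInter fun k => isClosed_iInter fun _ => isClosed_iInter fun l => ?_
  refine isClosed_le ?_ continuous_const
  refine Continuous.abs (Continuous.sub ?_ continuous_const)
  exact continuous_finsetSum _ fun j _ =>
    hφ.comp ((hT.iterate j).comp (hT.iterate l))

lemma aux_maps (T : X → X) (φ : X → ℝ) (Cs : ℝ) {x : X} (hx : x ∈ Khat T φ Cs) :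
    T x ∈ Khat T φ Cs := by
  intro k hk l
  have := hx k hk (l+1)
  simpa only [Function.iterate_succ_apply] using this

lemma aux_msupp_subset (μ : Measure X) (F : Set X) (hF : IsClosed F) (h : μ Fᶜ = 0) :
    msupp μ ⊆ F := by
  intro x hx
  by_contra hxF
  have := hx Fᶜ hF.isOpen_compl hxF
  rw [h] at this
  exact lt_irrefl _ this

lemma aux_msupp_null [CompactSpace X] (μ : Measure X) : μ (msupp μ)ᶜ = 0 := by
  refine measure_null_of_locally_null _ fun x hx => ?_
  simp only [msupp, mem_compl_iff, mem_setOf_eq, not_forall, not_lt, nonpos_iff_eq_zero] at hx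
  obtain ⟨U, hU, hxU, h0⟩ := hx
  exact ⟨U, mem_nhdsWithin_of_mem_nhds (hU.mem_nhds hxU), h0⟩

lemma aux_ae [CompactSpace X] [BorelSpace X] (T : X → X) (hT : Continuous T)
    (φ : X → ℝ) (hφ : Continuous φ) (Cs b : ℝ) (hCs : 0 < Cs)
    (hγ : ∀ n : ℕ, 1 ≤ n → ∀ x : X, ∑ k ∈ Finset.range n, φ (T^[k] x) - n * b ≤ Cs)
    (μ : Measure X) [IsProbabilityMeasure μ] (hμ : MeasurePreserving T μ μ)
    (hb : ∫ x, φ x ∂μ = b) :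
    ∀ᵐ x ∂μ, ∀ n : ℕ, -Cs ≤ ∑ k ∈ Finset.range n, φ (T^[k] x) - n * b := by
  set S : ℕ → X → ℝ := fun n x => ∑ k ∈ Finset.range n, φ (T^[k] x) - n * b with hS
  set h : X → ℝ := fun x => ⨆ n, S n x with hh
  have hSle : ∀ n x, S n x ≤ Cs := by
    intro n x
    rcases Nat.eq_zero_or_pos n with rfl | hn
    · simpa [hS] using hCs.le
    · exact hγ n hn x
  have hbdd : ∀ x, BddAbove (range fun n => S n x) := fun x =>
    ⟨Cs, by rintro _ ⟨n, rfl⟩; exact hSle n x⟩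
  have hle : ∀ x, h x ≤ Cs := fun x => ciSup_le fun n => hSle n x
  have hnn : ∀ x, 0 ≤ h x := fun x => by
    have := le_ciSup (hbdd x) 0
    simpa [hS] using this
  have hSc : ∀ n, Continuous (S n) := fun n =>
    (continuous_finsetSum _ fun j _ => hφ.comp (hT.iterate j)).sub continuous_const
  have hmeas : Measurable h := Measurable.iSup fun n => (hSc n).measurable
  have hint : Integrable h μ := by
    refine Integrable.of_bound hmeas.aestronglyMeasurable Cs (ae_of_all _ fun x => ?_)
    rw [Real.norm_eq_abs, abs_of_nonneg (hnn x)]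
    exact hle x
  have hintT : Integrable (fun x => h (T x)) μ := hμ.integrable_comp_of_integrable hint
  have hφi : Integrable φ μ := hφ.integrable_of_hasCompactSupport (HasCompactSupport.of_compactSpace φ)
  have hφb : Integrable (fun x => φ x - b) μ := hφi.sub (integrable_const b)
  have hsum : Integrable (fun x => φ x - b + h (T x)) μ := hφb.add hintT
  have hcob : ∀ x, φ x - b + h (T x) ≤ h x := by
    intro x
    have : h (T x) ≤ h x - (φ x - b) := by
      refine ciSup_le fun n => ?_
      have h1 := le_ciSup (hbdd x) (n+1)
      have h2 : S (n+1) x = φ x - b + S n (T x) := by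
        simp only [hS, aux_sum_succ]
        push_cast
        ring
      simp only [hh] at *
      linarith
    linarith
  have hTint : ∫ x, h (T x) ∂μ = ∫ x, h x ∂μ := by
    have := integral_map (μ := μ) hμ.measurable.aemeasurable (f := h)
      hmeas.aestronglyMeasurable
    rw [hμ.map_eq] at this
    exact this.symm
  have hzero : ∫ x, (h x - (φ x - b + h (T x))) ∂μ = 0 := by
    rw [integral_sub hint hsum,
      integral_add hφb hintT,
      integral_sub hφi (integrable_const b), hTint, hb]
    simp
  have hae : ∀ᵐ x ∂μ, h x = φ x - b + h (T x) := by
    have := (integral_eq_zero_iff_of_nonneg (fun x => sub_nonneg.2 (hcob x))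
      (hint.sub hsum)).1 hzero
    filter_upwards [this] with x hx
    simpa [sub_eq_zero] using hx
  have hall : ∀ᵐ x ∂μ, ∀ j : ℕ, h (T^[j] x) = φ (T^[j] x) - b + h (T (T^[j] x)) :=
    ae_all_iff.2 fun j => (hμ.iterate j).quasiMeasurePreserving.ae hae
  filter_upwards [hall] with x hx n
  have key : ∀ n : ℕ, S n x = h x - h (T^[n] x) := by
    intro n
    induction n with
    | zero => simp [hS]
    | succ n ih =>
      have h1 := hx n
      have h2 : S (n+1) x = S n x + (φ (T^[n] x) - b) := by
        simp only [hS, Finset.sum_range_succ]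
        push_cast
        ring
      rw [Function.iterate_succ_apply', h2, ih]
      linarith
  have := key n
  have h3 := hnn x
  have h4 := hle (T^[n] x)
  change -Cs ≤ S n x
  linarith

end helpers

/-- for `φ` in an open subset `V*` of `Lip(X)` on which
`γ(φ) ≤ C*`, the set `K_φ` is compact, `T(K_φ) = K_φ`, and an invariant
measure `μ` maximizes `φ` iff `supp μ ⊆ K_φ`. -/
theorem stmt10 {X : Type*} [MetricSpace X] [CompactSpace X]
    [MeasurableSpace X] [BorelSpace X]
    (T : X → X) (hT : Continuous T)
    (Cs : ℝ) (hCs : 0 < Cs)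
    (Vs : Set (X → ℝ))
    (hVlip : ∀ φ ∈ Vs, ∃ K : NNReal, LipschitzWith K φ)
    (hVγ : ∀ φ ∈ Vs, ∀ n : ℕ, 1 ≤ n → ∀ x : X,
      ∑ k ∈ Finset.range n, φ (T^[k] x) - n * beta T φ ≤ Cs) :
    ∀ φ ∈ Vs,
      IsCompact (Kset T φ Cs) ∧
      T '' Kset T φ Cs = Kset T φ Cs ∧
      ∀ μ : Measure X, IsProbabilityMeasure μ → μ.map T = μ →
        (∫ x, φ x ∂μ = beta T φ ↔ msupp μ ⊆ Kset T φ Cs) := by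
  intro φ hφV
  obtain ⟨K, hK⟩ := hVlip φ hφV
  have hφ : Continuous φ := hK.continuous
  have hγ := hVγ φ hφV
  have hKc := aux_closed T hT φ hφ Cs
  have hAc : ∀ m : ℕ, IsClosed (T^[m] '' Khat T φ Cs) := fun m =>
    (hKc.isCompact.image (hT.iterate m)).isClosed
  have hanti : ∀ m : ℕ, T^[m+1] '' Khat T φ Cs ⊆ T^[m] '' Khat T φ Cs := by
    rintro m _ ⟨x, hx, rfl⟩
    exact ⟨T x, aux_maps T φ Cs hx, (Function.iterate_succ_apply T m x).symm⟩
  refine ⟨(isClosed_iInter hAc).isCompact, ?_, ?_⟩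
  · apply Subset.antisymm
    · rintro _ ⟨x, hx, rfl⟩
      refine mem_iInter.2 fun m => hanti m ?_
      obtain ⟨y, hy, hyx⟩ := mem_iInter.1 hx m
      exact ⟨y, hy, by rw [Function.iterate_succ_apply', hyx]⟩
    · intro x hx
      have hpc : IsClosed (T ⁻¹' {x}) := isClosed_singleton.preimage hT
      have := IsCompact.nonempty_iInter_of_sequence_nonempty_isCompact_isClosed
        (fun m : ℕ => T^[m] '' Khat T φ Cs ∩ T ⁻¹' {x})
        (fun m => inter_subset_inter_left _ (hanti m))
        (fun m => by
          obtain ⟨y, hy, hyx⟩ := mem_iInter.1 hx (m+1)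
          exact ⟨T^[m] y, ⟨y, hy, rfl⟩, by
            rw [Function.iterate_succ_apply'] at hyx; exact hyx⟩)
        ((hAc 0).inter hpc).isCompact
        (fun m => (hAc m).inter hpc)
      obtain ⟨y, hy⟩ := this
      rw [mem_iInter] at hy
      exact ⟨y, mem_iInter.2 fun m => (hy m).1, (hy 0).2⟩
  · intro μ hprob hinv
    have hμ : MeasurePreserving T μ μ := ⟨hT.measurable, hinv⟩
    constructor
    · intro hb
      have hae := aux_ae T hT φ hφ Cs _ hCs hγ μ hμ hb
      have hKae : ∀ᵐ x ∂μ, x ∈ Khat T φ Cs := by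
        have hall : ∀ᵐ x ∂μ, ∀ l : ℕ, ∀ n : ℕ,
            -Cs ≤ ∑ k ∈ Finset.range n, φ (T^[k] (T^[l] x)) - n * beta T φ :=
          ae_all_iff.2 fun l => (hμ.iterate l).quasiMeasurePreserving.ae hae
        filter_upwards [hall] with x hx k hk l
        exact abs_le.2 ⟨hx l k, hγ k hk _⟩
      refine subset_iInter fun m => aux_msupp_subset μ _ (hAc m) ?_
      rw [← (hμ.iterate m).measure_preimage (hAc m).measurableSet.compl.nullMeasurableSet]
      refine measure_mono_null ?_ (show μ (Khat T φ Cs)ᶜ = 0 from hKae)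
      intro x hx hxK
      exact hx ⟨x, hxK, rfl⟩
    · intro hsub
      have hKae : ∀ᵐ x ∂μ, x ∈ Khat T φ Cs := by
        refine measure_mono_null ?_ (aux_msupp_null μ)
        intro x hx hxs
        apply hx
        have := mem_iInter.1 (hsub hxs) 0
        simpa using this
      have hcint : ∀ f : X → ℝ, Continuous f → Integrable f μ := fun f hf =>
        hf.integrable_of_hasCompactSupport (HasCompactSupport.of_compactSpace f)
      have hj : ∀ j : ℕ, ∫ x, φ (T^[j] x) ∂μ = ∫ x, φ x ∂μ := by
        intro j
        have := integral_map (μ := μ) (hμ.iterate j).measurable.aemeasurable (f := φ)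
          hφ.measurable.aestronglyMeasurable
        rw [(hμ.iterate j).map_eq] at this
        exact this.symm
      have hbound : ∀ k : ℕ, 1 ≤ k → k * |∫ x, φ x ∂μ - beta T φ| ≤ Cs := by
        intro k hk
        have h1 : ∫ x, (∑ j ∈ Finset.range k, φ (T^[j] x) - k * beta T φ) ∂μ
            = k * (∫ x, φ x ∂μ - beta T φ) := by
          have hi : ∀ j : ℕ, Integrable (fun x => φ (T^[j] x)) μ := fun j =>
            hcint _ (hφ.comp (hT.iterate j))
          rw [integral_sub (integrable_finsetSum _ fun j _ => hi j) (integrable_const _),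
            integral_finsetSum _ fun j _ => hi j]
          simp [hj, mul_sub]
        have h2 : ‖∫ x, (∑ j ∈ Finset.range k, φ (T^[j] x) - k * beta T φ) ∂μ‖ ≤
            Cs * μ.real univ := by
          refine norm_integral_le_of_norm_le_const ?_
          filter_upwards [hKae] with x hx
          exact hx k hk 0
        rw [h1, Real.norm_eq_abs, abs_mul, Nat.abs_cast] at h2
        simpa using h2
      by_contra hne
      have hpos : 0 < |∫ x, φ x ∂μ - beta T φ| := abs_pos.2 (sub_ne_zero.2 hne)
      obtain ⟨n, hn⟩ := exists_nat_gt (Cs / |∫ x, φ x ∂μ - beta T φ|)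
      have h3 := hbound (n+1) (by omega)
      rw [div_lt_iff₀ hpos] at hn
      push_cast at h3
      nlinarith
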